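/- arXiv:2312.02122 — 4 statements merged into one kernel-verified Lean document; each statement's English description precedes it below -/
import Mathlib

section
/- For every real number t ≥ 1, the closed rectangle {x ∈ ℝ² : |x₁| ≤ t/2 and |x₂| ≤ 1/2} is contained in the topological interior of the convex hull (over ℝ) of the union of the closed Euclidean unit ball centered at the origin with the two points (t, 0) and (-t, 0). -/
/-- The point in the Euclidean plane with coordinates `(a, b)`. -/
noncomputable def pt (a b : ℝ) : EuclideanSpace ℝ (Fin 2) :=
  (WithLp.equiv 2 (Fin 2 → ℝ)).symm ![a, b]

theorem exists_weight_sq_lt {t a : ℝ} (ht : 1 ≤ t) (ha : 0 ≤ a) (ha' : a ≤ 1 / 2) :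
    ∃ s : ℝ, 0 ≤ s ∧ s < 1 ∧ t ^ 2 * (a - s) ^ 2 + 1 / 4 < (1 - s) ^ 2 := by
  have ht2 : 1 ≤ t ^ 2 := one_le_pow₀ ht
  obtain ⟨e, he⟩ : ∃ e : ℝ, e = 1 / (2 * t ^ 2) := ⟨_, rfl⟩
  have hte : t ^ 2 * e = 1 / 2 := by rw [he]; field_simp
  have he0 : 0 < e := by rw [he]; positivity
  have he1 : e ≤ 1 / 2 := by nlinarith
  rcases le_total e a with h | h
  · refine ⟨a - e, by linarith, by linarith, ?_⟩
    have h1 : t ^ 2 * (a - (a - e)) ^ 2 = e / 2 := by linear_combination e * hte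
    rw [h1]
    nlinarith
  · refine ⟨0, le_rfl, one_pos, ?_⟩
    have h1 : t ^ 2 * (a - 0) ^ 2 ≤ t ^ 2 * e ^ 2 := by
      rw [sub_zero]
      gcongr
    have h2 : t ^ 2 * e ^ 2 = e / 2 := by linear_combination e * hte
    linarith

/-- A point within distance `1 - s` of `s • p` lies in the interior of the convex hull of
the unit ball and any set containing `p`. -/
theorem mem_interior_convexHull_of_norm_sub_lt {E : Type*} [NormedAddCommGroup E]
    [NormedSpace ℝ E] {S : Set E} {p x : E} {s : ℝ} (hp : p ∈ S) (hs : 0 ≤ s) (hs' : s < 1)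
    (h : ‖x - s • p‖ < 1 - s) :
    x ∈ interior (convexHull ℝ (Metric.closedBall (0 : E) 1 ∪ S)) := by
  have hs1 : 0 < 1 - s := sub_pos.2 hs'
  have hy : (1 - s)⁻¹ • (x - s • p) ∈
      interior (convexHull ℝ (Metric.closedBall (0 : E) 1 ∪ S)) := by
    refine interior_mono (Set.subset_union_left.trans (subset_convexHull ℝ _))
      (Metric.ball_subset_interior_closedBall ?_)
    rw [mem_ball_zero_iff, norm_smul, norm_inv, Real.norm_of_nonneg hs1.le,
      inv_mul_lt_one₀ hs1]
    exact h
  have hmem := (convex_convexHull ℝ _).combo_interior_self_mem_interior hy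
    (subset_convexHull ℝ _ (Set.mem_union_right _ hp)) hs1 hs (sub_add_cancel 1 s)
  rwa [smul_inv_smul₀ hs1.ne', sub_add_cancel] at hmem

/-- For `t ≥ 1`, the rectangle `[-t/2, t/2] × [-1/2, 1/2]` is contained in the interior
of the convex hull of the closed unit disk together with the points `(±t, 0)`. -/
theorem rectangle_subset_interior_hull (t : ℝ) (ht : 1 ≤ t) :
    {x : EuclideanSpace ℝ (Fin 2) | |x 0| ≤ t / 2 ∧ |x 1| ≤ 1 / 2} ⊆
      interior (convexHull ℝ
        (Metric.closedBall (0 : EuclideanSpace ℝ (Fin 2)) 1 ∪ {pt t 0, pt (-t) 0})) := by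
  rintro x ⟨hx0, hx1⟩
  have ht0 : 0 < t := by linarith
  obtain ⟨s, hs0, hs1, hs⟩ := exists_weight_sq_lt ht (a := |x 0| / t) (by positivity)
    (by rw [div_le_iff₀ ht0]; linarith)
  obtain ⟨q, hq, hqt, hqx⟩ : ∃ q : ℝ, pt q 0 ∈ ({pt t 0, pt (-t) 0} : Set _) ∧
      q ^ 2 = t ^ 2 ∧ |x 0| / t * q = x 0 := by
    rcases le_total 0 (x 0) with h | h
    · exact ⟨t, by simp, rfl, by rw [abs_of_nonneg h]; field_simp⟩
    · exact ⟨-t, by simp, by ring, by rw [abs_of_nonpos h]; field_simp⟩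
  refine mem_interior_convexHull_of_norm_sub_lt hq hs0 hs1 ?_
  rw [EuclideanSpace.norm_eq, Real.sqrt_lt' (sub_pos.2 hs1)]
  have hx1' : x 1 ^ 2 ≤ 1 / 4 := by
    rw [← sq_abs]
    nlinarith [abs_nonneg (x 1)]
  have hx0' : (x 0 - s * q) ^ 2 = t ^ 2 * (|x 0| / t - s) ^ 2 := by
    rw [← hqt, ← mul_pow, mul_sub, mul_comm q, hqx, mul_comm q]
  have hnorm : ∑ i, ‖(x - s • pt q 0) i‖ ^ 2 = (x 0 - s * q) ^ 2 + x 1 ^ 2 := by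
    simp [pt, Fin.sum_univ_two]
  linarith
end

section
/- Let Q be a convex subset of the Euclidean plane that contains the closed unit disk centered at the origin, and suppose that for some real t ≥ 1 both points (t, 0) and (-t, 0) lie in the topological interior of Q. Then the closed elliptical region {x ∈ ℝ² : 4x₁²/t² + 4x₂² ≤ 1} (an ellipse with semi-axes t/2 and 1/2 centered at the origin) is contained in the interior of Q. -/
@[simp]
theorem pt_apply_zero (a b : ℝ) : pt a b 0 = a := rfl

@[simp]
theorem pt_apply_one (a b : ℝ) : pt a b 1 = b := rfl

/-- If a convex set `Q` in the plane contains the closed unit disk and, for some `t ≥ 1`,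
the points `(±t, 0)` lie in its interior, then the closed ellipse with semi-axes `t/2`
and `1/2` is contained in the interior of `Q`. -/
theorem ellipse_subset_interior (Q : Set (EuclideanSpace ℝ (Fin 2))) (hQ : Convex ℝ Q)
    (hball : Metric.closedBall (0 : EuclideanSpace ℝ (Fin 2)) 1 ⊆ Q)
    (t : ℝ) (ht : 1 ≤ t)
    (hp : pt t 0 ∈ interior Q) (hm : pt (-t) 0 ∈ interior Q) :
    {x : EuclideanSpace ℝ (Fin 2) | 4 * (x 0) ^ 2 / t ^ 2 + 4 * (x 1) ^ 2 ≤ 1} ⊆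
      interior Q := by
  intro x hx
  have ht0 : 0 < t := by linarith
  obtain ⟨u, hu⟩ : ∃ u, x 0 = u * t := ⟨x 0 / t, by field_simp⟩
  have hE : 4 * u ^ 2 + 4 * (x 1) ^ 2 ≤ 1 := by
    have h : 4 * (x 0) ^ 2 / t ^ 2 = 4 * u ^ 2 := by rw [hu]; field_simp
    rw [← h]
    exact hx
  obtain ⟨hu1, hu2⟩ : -1 ≤ 2 * u ∧ 2 * u ≤ 1 :=
    abs_le.mp (abs_le_one_iff_mul_self_le_one.mpr (by nlinarith [sq_nonneg (x 1)]))
  have hhor : pt (2 * u * t) 0 ∈ interior Q := by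
    have h := hQ.interior hp hm (a := (1 + 2 * u) / 2) (b := (1 - 2 * u) / 2)
      (by linarith) (by linarith) (by ring)
    convert h using 1
    ext i
    fin_cases i
    · simp
      ring
    · simp
  have hver : pt 0 (2 * x 1) ∈ Q := by
    apply hball
    rw [mem_closedBall_zero_iff, EuclideanSpace.norm_eq, Real.sqrt_le_left zero_le_one, one_pow]
    simp only [Fin.sum_univ_two, pt_apply_zero, pt_apply_one, Real.norm_eq_abs, sq_abs]
    nlinarith [sq_nonneg u]
  have h := hQ.combo_interior_self_mem_interior hhor hver (a := 1 / 2) (b := 1 / 2)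
    (by norm_num) (by norm_num) (by norm_num)
  convert h using 1
  ext i
  fin_cases i
  · simp [hu]
    ring
  · simp
end

section
/- Let P be a compact convex subset of the Euclidean plane with P = -P. Fix a > 0, and for h > 0 let E(h) = {x ∈ ℝ² : x₁²/a² + x₂²/h² ≤ 1}. Assume E(1/2) ⊆ interior P and that the point (0, 1) lies on the frontier (topological boundary) of P. Then there exists h with 1/2 ≤ h ≤ 1 such that E(h) ⊆ P and the intersection of the frontier of E(h) with the frontier of P is nonempty. -/
theorem continuous_pt_const_left (b : ℝ → ℝ) (a : ℝ) (hb : Continuous b) :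
    Continuous fun t => pt a (b t) := by
  refine (PiLp.continuous_toLp 2 _).comp (continuous_pi fun i => ?_)
  fin_cases i
  · exact continuous_const
  · exact hb

theorem inter_frontier_nonempty_of_isPreconnected {X : Type*} [TopologicalSpace X] {s t : Set X}
    (hs : IsPreconnected s) (h : (s ∩ t).Nonempty) (h' : (s ∩ tᶜ).Nonempty) :
    (s ∩ frontier t).Nonempty := by
  by_contra hne
  have hfr : ∀ x ∈ s, x ∈ closure t → x ∈ interior t := fun x hx hc => by
    by_contra hi
    exact hne ⟨x, hx, hc, hi⟩
  obtain ⟨x, hxs, hxt⟩ := h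
  obtain ⟨y, hys, hyt⟩ := h'
  obtain ⟨z, -, hzi, hzc⟩ := hs (interior t) (closure t)ᶜ isOpen_interior
    isClosed_closure.isOpen_compl
    (fun z hz => (em (z ∈ closure t)).imp (hfr z hz) id)
    ⟨x, hxs, hfr x hxs (subset_closure hxt)⟩
    ⟨y, hys, fun hc => hyt (interior_subset (hfr y hys hc))⟩
  exact hzc (interior_subset_closure hzi)

/-- Maximal inscribed ellipse step: for an origin-symmetric compact convex plane set `P`
with `E(1/2) ⊆ interior P` and `(0,1) ∈ frontier P`, where `E(h)` is the closed ellipse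
with semi-axes `a` and `h`, there is an `h ∈ [1/2, 1]` with `E(h) ⊆ P` and the boundary
of `E(h)` touching the boundary of `P`. -/
theorem maximal_inscribed_ellipse (P : Set (EuclideanSpace ℝ (Fin 2)))
    (hPc : IsCompact P) (hPconv : Convex ℝ P) (hPsym : P = -P)
    (a : ℝ) (ha : 0 < a)
    (E : ℝ → Set (EuclideanSpace ℝ (Fin 2)))
    (hE : ∀ h : ℝ, 0 < h →
      E h = {x : EuclideanSpace ℝ (Fin 2) | (x 0) ^ 2 / a ^ 2 + (x 1) ^ 2 / h ^ 2 ≤ 1})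
    (hEhalf : E (1 / 2) ⊆ interior P)
    (hfront : pt 0 1 ∈ frontier P) :
    ∃ h : ℝ, 1 / 2 ≤ h ∧ h ≤ 1 ∧ E h ⊆ P ∧ (frontier (E h) ∩ frontier P).Nonempty := by
  have hmem : ∀ h : ℝ, 0 < h → ∀ x : EuclideanSpace ℝ (Fin 2),
      x ∈ E h ↔ (x 0) ^ 2 / a ^ 2 * h ^ 2 + (x 1) ^ 2 ≤ h ^ 2 := fun h hh x => by
    rw [hE h hh, Set.mem_ofPred_eq, ← mul_le_mul_iff_left₀ (pow_pos hh 2), add_mul,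
      div_mul_cancel₀ _ (pow_pos hh 2).ne', one_mul]
  let C : Set (ℝ × EuclideanSpace ℝ (Fin 2)) := Set.Icc (1 / 2) 1 ×ˢ frontier P ∩
    {p | (p.2 0) ^ 2 / a ^ 2 * p.1 ^ 2 + (p.2 1) ^ 2 ≤ p.1 ^ 2}
  have hfc : IsCompact (frontier P) :=
    hPc.of_isClosed_subset isClosed_frontier hPc.isClosed.frontier_subset
  have hC : IsCompact C := (isCompact_Icc.prod hfc).inter_right
    (isClosed_le (by fun_prop) (by fun_prop))
  have hCne : C.Nonempty :=
    ⟨(1, pt 0 1), ⟨by norm_num, hfront⟩, by simp [pt]⟩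
  -- The smallest parameter whose ellipse meets the frontier of `P`.
  obtain ⟨⟨h, x⟩, ⟨⟨⟨hh1, hh2⟩, hxP⟩, hx⟩, hmin⟩ :=
    hC.exists_isMinOn hCne continuous_fst.continuousOn
  dsimp only at hh1 hh2 hxP
  have hpos : 0 < h := by linarith
  have hxE : x ∈ E h := (hmem h hpos x).2 hx
  have hsub : E h ⊆ P := by
    intro y hy
    by_contra hyP
    let γ : ℝ → EuclideanSpace ℝ (Fin 2) := fun t => pt (y 0) (t * (y 1 / h))
    have hγ : Continuous γ := continuous_pt_const_left _ _ (by fun_prop)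
    have hγE : ∀ t, 0 < t → γ t ∈ E t := fun t ht => by
      rw [hE h hpos] at hy
      rw [hE t ht]
      have : (t * (y 1 / h)) ^ 2 / t ^ 2 = (y 1) ^ 2 / h ^ 2 := by field_simp
      simpa [γ, pt, this] using hy
    have hγh : γ h = y := by
      ext i
      fin_cases i
      · simp [γ, pt]
      · simp [γ, pt]; field_simp
    obtain ⟨_, ⟨t, ht, rfl⟩, htP⟩ := inter_frontier_nonempty_of_isPreconnected
      (isPreconnected_Icc.image γ hγ.continuousOn) (t := P)
      ⟨γ (1 / 2), ⟨_, ⟨le_rfl, hh1⟩, rfl⟩, interior_subset (hEhalf (hγE _ (by norm_num)))⟩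
      ⟨γ h, ⟨_, ⟨hh1, le_rfl⟩, rfl⟩, by rwa [hγh]⟩
    have ht0 : 0 < t := by linarith [ht.1]
    have hle : h ≤ t := hmin (show (t, γ t) ∈ C from
      ⟨⟨⟨ht.1, ht.2.trans hh2⟩, htP⟩, (hmem t ht0 _).1 (hγE t ht0)⟩)
    obtain rfl : t = h := le_antisymm ht.2 hle
    exact hyP (hγh ▸ hPc.isClosed.frontier_subset htP)
  exact ⟨h, hh1, hh2, hsub, x, ⟨subset_closure hxE, fun hi => hxP.2 (interior_mono hsub hi)⟩, hxP⟩
end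

section
/- Let n ≥ 1 be a natural number, let R > 0 and h > 0 be real numbers, and let θ ∈ [-π/2, 0). If (-h·sin θ) / (R/√(n+1) − (R/(2√(n+1)))·cos θ) ≥ −(4(n+1)h²/R²) · ((R/(2√(n+1)))·cos θ) / (h·sin θ), then sin²θ ≥ 3/4. -/
open Real

/-- Slope comparison step in the Chou–Wang lemma: for `θ ∈ [-π/2, 0)`, if the slope of
the chord from the contact point `((R/(2√(n+1)))cos θ, h sin θ)` to `(R/√(n+1), 0)`
dominates the slope of the tangent line of the ellipse at the contact point, then
`sin² θ ≥ 3/4`. -/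
theorem slope_comparison (n : ℕ) (hn : 1 ≤ n) (R h θ : ℝ) (hR : 0 < R) (hh : 0 < h)
    (hθ1 : -(π / 2) ≤ θ) (hθ2 : θ < 0)
    (hineq : (-(h * Real.sin θ)) /
        (R / Real.sqrt (n + 1) - R / (2 * Real.sqrt (n + 1)) * Real.cos θ) ≥
      -(4 * (n + 1) * h ^ 2 / R ^ 2) *
        (R / (2 * Real.sqrt (n + 1)) * Real.cos θ) / (h * Real.sin θ)) :
    Real.sin θ ^ 2 ≥ 3 / 4 := by
  have hs : Real.sin θ < 0 := Real.sin_neg_of_neg_of_neg_pi_lt hθ2 (by linarith [Real.pi_pos])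
  have hc : 0 ≤ Real.cos θ :=
    Real.cos_nonneg_of_neg_pi_div_two_le_of_le hθ1 (by linarith [Real.pi_pos])
  have hc1 : 0 < 2 - Real.cos θ := by linarith [Real.cos_le_one θ]
  have hsc := Real.sin_sq_add_cos_sq θ
  have hS : 0 < Real.sqrt (n + 1) := by positivity
  have hS2 : Real.sqrt (n + 1) ^ 2 = (n : ℝ) + 1 := Real.sq_sqrt (by positivity)
  rw [← hS2, Real.sqrt_sq hS.le] at hineq
  generalize Real.sqrt (n + 1) = S at hineq hS
  generalize Real.sin θ = s at *
  generalize Real.cos θ = c at *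
  have chord : -(h * s) / (R / S - R / (2 * S) * c) = 2 * S * h / R * (-s / (2 - c)) := by
    have hden : R / S - R / (2 * S) * c = R * (2 - c) / (2 * S) := by
      field_simp
    rw [hden]
    field_simp
  have tangent : -(4 * S ^ 2 * h ^ 2 / R ^ 2) * (R / (2 * S) * c) / (h * s)
      = 2 * S * h / R * (c / -s) := by
    have := hs.ne
    field_simp
    ring
  rw [chord, tangent] at hineq
  have slopes : c / -s ≤ -s / (2 - c) := le_of_mul_le_mul_left hineq (by positivity)
  rw [div_le_div_iff₀ (neg_pos.mpr hs) hc1] at slopes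
  nlinarith
end
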